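/- Let n ≥ 2 and d ∈ (0, n], and let ‖·‖_Y be a rearrangement-invariant function norm on (0,1). Then the functional ‖f‖_Z := ‖ t ↦ f*(t^{n/d}) ‖_Y, defined for measurable f : (0,1) → [0,∞], is itself a rearrangement-invariant function norm on (0,1); in particular it satisfies the triangle inequality ‖f+g‖_Z ≤ ‖f‖_Z + ‖g‖_Z. -/

import Mathlib

open MeasureTheory Set
open scoped ENNReal NNReal

/-- Lebesgue measure on the interval `(0,1)`. -/
noncomputable def vol01 : MeasureTheory.Measure ℝ :=
  MeasureTheory.volume.restrict (Set.Ioo 0 1)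

/-- The non-increasing rearrangement on `(0,1)` of an extended-nonnegative function. -/
noncomputable def decRearr (f : ℝ → ℝ≥0∞) (s : ℝ) : ℝ≥0∞ :=
  sInf {ρ : ℝ≥0∞ | vol01 {t | ρ < f t} ≤ ENNReal.ofReal s}

/-- The non-increasing rearrangement of a real-valued function with respect to a measure. -/
noncomputable def rearr {α : Type*} [MeasurableSpace α] (ν : MeasureTheory.Measure α)
    (u : α → ℝ) (s : ℝ) : ℝ≥0∞ :=
  sInf {ρ : ℝ≥0∞ | ν {x | ρ < ENNReal.ofReal |u x|} ≤ ENNReal.ofReal s}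

/-- A rearrangement-invariant function norm on `(0,1)`: properties (P1)–(P6). -/
structure IsRINorm (N : (ℝ → ℝ≥0∞) → ℝ≥0∞) : Prop where
  eq_zero_iff : ∀ f : ℝ → ℝ≥0∞, N f = 0 ↔ (∀ᵐ t ∂vol01, f t = 0)
  smul : ∀ (c : ℝ≥0) (f : ℝ → ℝ≥0∞), N (fun t => (c : ℝ≥0∞) * f t) = (c : ℝ≥0∞) * N f
  add_le : ∀ f g : ℝ → ℝ≥0∞, N (fun t => f t + g t) ≤ N f + N g
  mono : ∀ f g : ℝ → ℝ≥0∞, (∀ᵐ t ∂vol01, f t ≤ g t) → N f ≤ N g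
  iSup_eq : ∀ (f : ℕ → ℝ → ℝ≥0∞) (g : ℝ → ℝ≥0∞),
    (∀ k, ∀ᵐ t ∂vol01, f k t ≤ f (k + 1) t) →
    (∀ᵐ t ∂vol01, (⨆ k, f k t) = g t) → N g = ⨆ k, N (f k)
  indicator_lt_top : ∀ E : Set ℝ, MeasurableSet E → E ⊆ Set.Ioo 0 1 → N (E.indicator 1) < ⊤
  exists_integral_le : ∀ E : Set ℝ, MeasurableSet E → E ⊆ Set.Ioo 0 1 →
    ∃ C : ℝ≥0, ∀ f : ℝ → ℝ≥0∞, (∫⁻ t in E, f t) ≤ (C : ℝ≥0∞) * N f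
  rearr_invariant : ∀ f g : ℝ → ℝ≥0∞, decRearr f = decRearr g → N f = N g

/-- The Hardy-type operator `S₁f(t) = ∫_{t^{n/d}}^1 f(s) s^{-1+m/n} ds`. -/
noncomputable def S1 (n m : ℕ) (d : ℝ) (f : ℝ → ℝ≥0∞) (t : ℝ) : ℝ≥0∞ :=
  ∫⁻ s in Set.Ioo (t ^ ((n : ℝ) / d)) 1, ENNReal.ofReal (s ^ ((m : ℝ) / n - 1)) * f s

/-- The Hardy-type operator
`S₂f(t) = t^{-m/(n-d)} ∫_0^{t^{n/d}} f(s) s^{-1+m/(n-d)} ds`. -/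
noncomputable def S2 (n m : ℕ) (d : ℝ) (f : ℝ → ℝ≥0∞) (t : ℝ) : ℝ≥0∞ :=
  ENNReal.ofReal (t ^ (-((m : ℝ) / ((n : ℝ) - d)))) *
    ∫⁻ s in Set.Ioo (0 : ℝ) (t ^ ((n : ℝ) / d)),
      ENNReal.ofReal (s ^ ((m : ℝ) / ((n : ℝ) - d) - 1)) * f s

theorem decRearr_le_iff {f : ℝ → ℝ≥0∞} {s : ℝ} {ρ : ℝ≥0∞} :
    decRearr f s ≤ ρ ↔ vol01 {t | ρ < f t} ≤ ENNReal.ofReal s := by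
  refine ⟨fun h => ?_, fun h => sInf_le h⟩
  rcases eq_or_ne ρ ⊤ with rfl | hρ
  · simp
  obtain ⟨u, hu_anti, hu_gt, hu_lim⟩ := exists_seq_strictAnti_tendsto' (lt_top_iff_ne_top.mpr hρ)
  have hU : {t | ρ < f t} = ⋃ n, {t | u n < f t} := by
    ext t
    simp only [mem_ofPred_eq, mem_iUnion]
    exact ⟨fun ht => (hu_lim.eventually_lt_const ht).exists,
      fun ⟨n, hn⟩ => (hu_gt n).1.trans hn⟩
  have hmono : Monotone fun n => {t | u n < f t} :=
    fun i j hij t ht => (hu_anti.antitone hij).trans_lt ht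
  rw [hU, hmono.measure_iUnion]
  refine iSup_le fun n => ?_
  obtain ⟨r, hr, hrn⟩ := sInf_lt_iff.mp (h.trans_lt (hu_gt n).1)
  exact (measure_mono fun t ht => hrn.trans ht).trans hr

theorem lt_decRearr_iff {f : ℝ → ℝ≥0∞} {s : ℝ} {ρ : ℝ≥0∞} :
    ρ < decRearr f s ↔ ENNReal.ofReal s < vol01 {t | ρ < f t} := by
  simpa only [not_le] using decRearr_le_iff.not

theorem decRearr_mono {f g : ℝ → ℝ≥0∞} (h : ∀ᵐ t ∂vol01, f t ≤ g t) (s : ℝ) :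
    decRearr f s ≤ decRearr g s :=
  decRearr_le_iff.mpr <| le_trans
    (measure_mono_ae (h.mono fun _ ht hf => lt_of_lt_of_le hf ht)) (decRearr_le_iff.mp le_rfl)

theorem decRearr_const_mul (c : ℝ≥0) (f : ℝ → ℝ≥0∞) (s : ℝ) :
    decRearr (fun t => (c : ℝ≥0∞) * f t) s = c * decRearr f s := by
  rcases eq_or_ne c 0 with rfl | hc
  · simpa using decRearr_le_iff (f := fun _ => 0) (s := s) (ρ := 0)
  have h0 : (c : ℝ≥0∞) ≠ 0 := by simpa using hc
  have ht : (c : ℝ≥0∞) ≠ ⊤ := ENNReal.coe_ne_top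
  refine eq_of_forall_ge_iff fun ρ => ?_
  rw [mul_comm, ← ENNReal.le_div_iff_mul_le (.inl h0) (.inl ht), decRearr_le_iff, decRearr_le_iff]
  simp only [ENNReal.div_lt_iff (.inl h0) (.inl ht), mul_comm]

theorem decRearr_iSup {f : ℕ → ℝ → ℝ≥0∞} {g : ℝ → ℝ≥0∞}
    (hf : ∀ k, ∀ᵐ t ∂vol01, f k t ≤ f (k + 1) t) (hg : ∀ᵐ t ∂vol01, (⨆ k, f k t) = g t) (s : ℝ) :
    ⨆ k, decRearr (f k) s = decRearr g s := by
  refine le_antisymm (iSup_le fun k => decRearr_mono ?_ s) ?_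
  · filter_upwards [hg] with t ht
    exact ht ▸ le_iSup (fun k => f k t) k
  set R := ⨆ k, decRearr (f k) s
  rw [decRearr_le_iff]
  set G : Set ℝ := {t | (∀ k, f k t ≤ f (k + 1) t) ∧ (⨆ k, f k t) = g t}
  have hG : ∀ᵐ t ∂vol01, t ∈ G := by
    filter_upwards [ae_all_iff.mpr hf, hg] with t h1 h2 using ⟨h1, h2⟩
  have hmono : Monotone fun k => {t | t ∈ G ∧ R < f k t} :=
    monotone_nat_of_le_succ fun k t ht => ⟨ht.1, ht.2.trans_le (ht.1.1 k)⟩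
  calc vol01 {t | R < g t} ≤ vol01 (⋃ k, {t | t ∈ G ∧ R < f k t}) := by
        refine measure_mono_ae (hG.mono fun t ht hR => ?_)
        have hR' : R < ⨆ k, f k t := ht.2 ▸ hR
        obtain ⟨k, hk⟩ := lt_iSup_iff.mp hR'
        exact mem_iUnion.mpr ⟨k, ht, hk⟩
    _ = ⨆ k, vol01 {t | t ∈ G ∧ R < f k t} := hmono.measure_iUnion
    _ ≤ ENNReal.ofReal s := iSup_le fun k => (measure_mono fun t ht => ht.2).trans
        (decRearr_le_iff.mp (le_iSup (fun k => decRearr (f k) s) k))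

theorem ae_vol01_mem : ∀ᵐ t ∂vol01, t ∈ Ioo (0 : ℝ) 1 := ae_restrict_mem measurableSet_Ioo

instance isProbabilityMeasure_vol01 : IsProbabilityMeasure vol01 :=
  ⟨by simp [vol01]⟩

theorem vol01_ofReal_lt {m : ℝ≥0∞} (hm : m ≤ 1) : vol01 {t | ENNReal.ofReal t < m} = m := by
  have hm' : m ≠ ⊤ := ne_top_of_le_ne_top ENNReal.one_ne_top hm
  have h1 : m.toReal ≤ 1 := ENNReal.toReal_le_of_le_ofReal zero_le_one (by simpa using hm)
  have hS : {t | ENNReal.ofReal t < m} ∩ Ioo 0 1 = Ioo 0 m.toReal := by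
    ext t
    simp only [mem_inter_iff, mem_ofPred_eq, mem_Ioo]
    constructor
    · rintro ⟨h, h0, -⟩
      exact ⟨h0, (ENNReal.ofReal_lt_iff_lt_toReal h0.le hm').mp h⟩
    · rintro ⟨h0, h⟩
      exact ⟨(ENNReal.ofReal_lt_iff_lt_toReal h0.le hm').mpr h, h0, h.trans_le h1⟩
  rw [vol01, Measure.restrict_apply (measurableSet_lt (by fun_prop) measurable_const), hS]
  simp [hm']

theorem decRearr_decRearr (f : ℝ → ℝ≥0∞) : decRearr (decRearr f) = decRearr f := by
  ext s
  refine eq_of_forall_ge_iff fun ρ => ?_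
  rw [decRearr_le_iff, decRearr_le_iff]
  simp only [lt_decRearr_iff]
  rw [vol01_ofReal_lt prob_le_one]

theorem IsRINorm.le_of_decRearr_le {N : (ℝ → ℝ≥0∞) → ℝ≥0∞} (hN : IsRINorm N)
    {f g : ℝ → ℝ≥0∞} (h : ∀ t ∈ Ioo (0 : ℝ) 1, decRearr f t ≤ g t) : N f ≤ N g := by
  rw [← hN.rearr_invariant _ _ (decRearr_decRearr f)]
  exact hN.mono _ _ (ae_vol01_mem.mono h)

theorem decRearr_le_self_of_antitoneOn {f : ℝ → ℝ≥0∞} (hf : AntitoneOn f (Ioo 0 1)) {s : ℝ}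
    (hs : s ∈ Ioo (0 : ℝ) 1) : decRearr f s ≤ f s := by
  rw [decRearr_le_iff, ← vol01_ofReal_lt (m := ENNReal.ofReal s) (by simpa using hs.2.le)]
  refine measure_mono_ae (ae_vol01_mem.mono fun t ht hlt => ?_)
  refine (ENNReal.ofReal_lt_ofReal_iff hs.1).mpr ?_
  by_contra! hst
  exact (hf hs ht hst).not_gt hlt

theorem exists_measurable_ge_decRearr_eq (f : ℝ → ℝ≥0∞) :
    ∃ g : ℝ → ℝ≥0∞, Measurable g ∧ f ≤ g ∧ decRearr g = decRearr f := by
  classical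
  let c : ℚ → ℝ≥0∞ := fun q => ((q : ℝ).toNNReal : ℝ≥0∞)
  let H : ℚ → Set ℝ := fun q => toMeasurable vol01 {t | c q < f t}
  have hH : ∀ q, MeasurableSet (H q) := fun q => measurableSet_toMeasurable _ _
  let g : ℝ → ℝ≥0∞ := fun t => ⨅ q, if t ∈ H q then ⊤ else c q
  have hfg : f ≤ g := fun t => le_iInf fun q => by
    split_ifs with h
    · exact le_top
    · by_contra! hlt
      exact h (subset_toMeasurable _ _ hlt)
  refine ⟨g, Measurable.iInf fun q => Measurable.ite (hH q) measurable_const measurable_const,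
    hfg, funext fun s => le_antisymm ?_ (decRearr_mono (ae_of_all _ hfg) s)⟩
  refine le_of_forall_gt_imp_ge_of_dense fun r hr => ?_
  obtain ⟨q, -, hq, hqr⟩ := ENNReal.lt_iff_exists_rat_btwn.mp hr
  refine le_trans ?_ hqr.le
  rw [decRearr_le_iff]
  refine le_trans (measure_mono fun t ht => ?_)
    ((measure_toMeasurable {t | c q < f t}).le.trans (decRearr_le_iff.mp hq.le))
  by_contra hn
  have : g t ≤ c q := (iInf_le _ q).trans (by rw [if_neg hn])
  exact this.not_gt ht

theorem rpow_mem_Ioo {p t : ℝ} (hp : 0 < p) (ht : t ∈ Ioo (0 : ℝ) 1) : t ^ p ∈ Ioo (0 : ℝ) 1 :=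
  ⟨Real.rpow_pos_of_pos ht.1 p, Real.rpow_lt_one ht.1.le ht.2 hp⟩

theorem setLIntegral_Ioo_rpow {p b : ℝ} (hp : 0 < p) (hb : 0 ≤ b) (φ : ℝ → ℝ≥0∞) :
    ∫⁻ t in Ioo 0 (b ^ p), φ t =
      ∫⁻ t in Ioo 0 b, ENNReal.ofReal (p * t ^ (p - 1)) * φ (t ^ p) := by
  have him : (fun t : ℝ => t ^ p) '' Ioo 0 b = Ioo 0 (b ^ p) := by
    ext y
    constructor
    · rintro ⟨t, ht, rfl⟩
      exact ⟨Real.rpow_pos_of_pos ht.1 p, Real.rpow_lt_rpow ht.1.le ht.2 hp⟩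
    · rintro ⟨h0, h1⟩
      refine ⟨y ^ p⁻¹, ⟨Real.rpow_pos_of_pos h0 _, ?_⟩, Real.rpow_inv_rpow h0.le hp.ne'⟩
      rwa [Real.rpow_inv_lt_iff_of_pos h0.le hb hp]
  rw [← him, lintegral_image_eq_lintegral_abs_deriv_mul measurableSet_Ioo
    (fun x hx => (Real.hasDerivAt_rpow_const (.inl hx.1.ne')).hasDerivWithinAt)
    ((Real.strictMonoOn_rpow_Ici_of_exponent_pos hp).injOn.mono fun x hx => hx.1.le)]
  refine setLIntegral_congr_fun measurableSet_Ioo fun t ht => ?_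
  rw [abs_of_nonneg (mul_nonneg hp.le (Real.rpow_nonneg ht.1.le _))]

theorem lintegral_vol01_rpow {p : ℝ} (hp : 0 < p) (φ : ℝ → ℝ≥0∞) :
    ∫⁻ t, φ t ∂vol01 = ∫⁻ t, ENNReal.ofReal (p * t ^ (p - 1)) * φ (t ^ p) ∂vol01 := by
  simpa [vol01] using setLIntegral_Ioo_rpow hp zero_le_one φ

/-- A set of measure at most `s ^ p` pulls back under `t ↦ t ^ p`, `p ≥ 1`, to a set of measure
at most `s`: the extremal case is the interval `(0, s ^ p)`. -/
theorem vol01_preimage_rpow_le {p : ℝ} (hp : 1 ≤ p) {A : Set ℝ} (hA : MeasurableSet A) {s : ℝ}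
    (hs : s ∈ Ioo (0 : ℝ) 1) (h : vol01 A ≤ ENNReal.ofReal (s ^ p)) :
    vol01 {t | t ^ p ∈ A} ≤ ENNReal.ofReal s := by
  have hp0 : 0 < p := by linarith
  set w : ℝ → ℝ≥0∞ := fun t => ENNReal.ofReal (p * t ^ (p - 1)) with hw
  set B : Set ℝ := {t | t ^ p ∈ A} ∩ Ioo 0 1 with hB
  set I : Set ℝ := Ioo 0 s with hI
  have hpre : MeasurableSet {t : ℝ | t ^ p ∈ A} :=
    (by fun_prop : Measurable fun t : ℝ => t ^ p) hA
  have hBm : MeasurableSet B := hpre.inter measurableSet_Ioo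
  have hIm : MeasurableSet I := measurableSet_Ioo
  have hwmono : ∀ {x y : ℝ}, 0 < x → x ≤ y → w x ≤ w y := fun hx hxy =>
    ENNReal.ofReal_le_ofReal (mul_le_mul_of_nonneg_left
      (Real.rpow_le_rpow hx.le hxy (by linarith)) hp0.le)
  have hws0 : w s ≠ 0 := by
    have := Real.rpow_pos_of_pos hs.1 (p - 1)
    simpa [hw] using mul_pos hp0 this
  have hwst : w s ≠ ⊤ := ENNReal.ofReal_ne_top
  have hwm : Measurable w := by fun_prop
  have hBint : ∫⁻ t in B, w t = vol01 A := by
    rw [← lintegral_indicator_one hA, lintegral_vol01_rpow hp0, hB, vol01,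
      ← Measure.restrict_restrict hpre, ← lintegral_indicator hpre]
    refine lintegral_congr fun t => ?_
    by_cases ht : t ^ p ∈ A <;> simp [indicator, ht, hw]
  have hIint : ∫⁻ t in I, w t = ENNReal.ofReal (s ^ p) := by
    simpa using (setLIntegral_Ioo_rpow hp0 hs.1.le 1).symm
  have hle : ∫⁻ t in B, w t ≤ ∫⁻ t in I, w t := by rw [hBint, hIint]; exact h
  have hdiff : ∫⁻ t in B \ I, w t ≤ ∫⁻ t in I \ B, w t := by
    rw [← lintegral_inter_add_sdiff w B hIm, ← lintegral_inter_add_sdiff w I hBm,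
      inter_comm I B] at hle
    refine (ENNReal.add_le_add_iff_left ?_).mp hle
    refine ne_top_of_le_ne_top ?_ (lintegral_mono_set inter_subset_right)
    rw [hIint]
    exact ENNReal.ofReal_ne_top
  have hlow : w s * volume (B \ I) ≤ ∫⁻ t in B \ I, w t := by
    rw [← setLIntegral_const]
    refine setLIntegral_mono hwm fun t ht => hwmono hs.1 ?_
    by_contra! hts
    exact ht.2 ⟨ht.1.2.1, hts⟩
  have hupp : ∫⁻ t in I \ B, w t ≤ w s * volume (I \ B) := by
    rw [← setLIntegral_const]
    exact setLIntegral_mono measurable_const fun t ht => hwmono ht.1.1 ht.1.2.le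
  have hvol : volume (B \ I) ≤ volume (I \ B) :=
    (ENNReal.mul_le_mul_iff_right hws0 hwst).mp (hlow.trans (hdiff.trans hupp))
  calc vol01 {t | t ^ p ∈ A} = volume B := Measure.restrict_apply hpre
    _ = volume (I ∩ B) + volume (B \ I) := by
        rw [inter_comm, measure_inter_add_sdiff B hIm]
    _ ≤ volume (I ∩ B) + volume (I \ B) := by gcongr
    _ = volume I := measure_inter_add_sdiff I hBm
    _ = ENNReal.ofReal s := by simp [hI]

theorem decRearr_comp_rpow_le {p : ℝ} (hp : 1 ≤ p) {f : ℝ → ℝ≥0∞} (hf : Measurable f) {s : ℝ}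
    (hs : s ∈ Ioo (0 : ℝ) 1) : decRearr (fun t => f (t ^ p)) s ≤ decRearr f (s ^ p) := by
  rw [decRearr_le_iff]
  exact vol01_preimage_rpow_le hp (measurableSet_lt measurable_const hf) hs
    (decRearr_le_iff.mp le_rfl)

theorem IsRINorm.comp_rpow_le {N : (ℝ → ℝ≥0∞) → ℝ≥0∞} (hN : IsRINorm N) {p : ℝ} (hp : 1 ≤ p)
    {f : ℝ → ℝ≥0∞} (hf : Measurable f) :
    N (fun t => f (t ^ p)) ≤ N (fun t => decRearr f (t ^ p)) :=
  hN.le_of_decRearr_le fun _ ht => decRearr_comp_rpow_le hp hf ht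

/-- The values of `h` on a finite set can be enumerated in decreasing order. -/
theorem Finset.exists_antitone_enumeration {α : Type*} (R : Finset α) (h : α → ℝ≥0∞) (a₀ : α)
    (h₀ : h a₀ = 0) :
    ∃ (ι : α → ℕ) (c : ℕ → α), (∀ v ∈ R, c (ι v) = v) ∧ Antitone fun i => h (c i) := by
  classical
  let e₀ := R.equivFin.symm
  let σ := Tuple.sort fun i => OrderDual.toDual (h (e₀ i))
  have hσ : ∀ {i j}, i ≤ j → h (e₀ (σ j)) ≤ h (e₀ (σ i)) := fun hij =>
    Tuple.monotone_sort (fun i => OrderDual.toDual (h (e₀ i))) hij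
  refine ⟨fun v => if hv : v ∈ R then (σ.symm (e₀.symm ⟨v, hv⟩) : ℕ) else 0,
    fun i => if hi : i < R.card then (e₀ (σ ⟨i, hi⟩) : α) else a₀, fun v hv => ?_, ?_⟩
  · simp [hv]
  · intro i j hij
    by_cases hj : j < R.card
    · simpa [hj, hij.trans_lt hj] using hσ (Fin.mk_le_mk.mpr hij)
    · simp [hj, h₀]

/-- An `ℕ`-valued simple function on `(0,1)` has an increasing rearrangement. -/
theorem exists_monotoneOn_map_eq (κ : SimpleFunc ℝ ℕ) :
    ∃ e : ℝ → ℕ, Measurable e ∧ MonotoneOn e (Ioo 0 1) ∧ vol01.map e = vol01.map κ := by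
  let m : ℕ → ℝ≥0∞ := fun i => vol01 {x | κ x ≤ i}
  have hm : Monotone m := fun i j hij => measure_mono fun x hx => le_trans hx hij
  have hm1 : m (κ.range.sup id) = 1 := by
    have : {x | κ x ≤ κ.range.sup id} = univ :=
      eq_univ_of_forall fun x => Finset.le_sup (f := id) (κ.mem_range_self x)
    simp only [m, this, measure_univ]
  let e : ℝ → ℕ := fun t => sInf {i | ENNReal.ofReal t < m i}
  have he : ∀ t < 1, ∀ i, e t ≤ i ↔ ENNReal.ofReal t < m i := fun t ht i => by
    have hne : {i | ENNReal.ofReal t < m i}.Nonempty :=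
      ⟨_, by rw [mem_ofPred_eq, hm1]; simpa using ht⟩
    exact ⟨fun h => (Nat.sInf_mem hne).trans_le (hm h), fun h => Nat.sInf_le h⟩
  have he' : ∀ t, 1 ≤ t → e t = 0 := fun t ht => by
    have : {i | ENNReal.ofReal t < m i} = ∅ := eq_empty_of_forall_notMem fun i hi =>
      (hi.trans_le prob_le_one).not_ge (by simpa using ht)
    simp only [e, this, Nat.sInf_empty]
  have hme : Measurable e := measurable_of_Iic fun i => by
    have : e ⁻¹' Iic i = Ici 1 ∪ {t | ENNReal.ofReal t < m i} := by
      ext t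
      rcases lt_or_ge t 1 with ht | ht
      · simp [he t ht, ht.not_ge]
      · simp [he' t ht, ht]
    rw [this]
    exact measurableSet_Ici.union (measurableSet_lt (by fun_prop) measurable_const)
  refine ⟨e, hme, fun s hs t ht hst => ?_, ?_⟩
  · rw [he s hs.2]
    exact (ENNReal.ofReal_le_ofReal hst).trans_lt ((he t ht.2 _).mp le_rfl)
  · refine Measure.ext_of_Iic _ _ fun i => ?_
    rw [Measure.map_apply hme measurableSet_Iic, Measure.map_apply κ.measurable measurableSet_Iic]
    calc vol01 (e ⁻¹' Iic i) = vol01 {t | ENNReal.ofReal t < m i} :=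
          measure_congr (ae_vol01_mem.mono fun t ht => propext (he t ht.2 i))
      _ = m i := vol01_ofReal_lt prob_le_one

theorem decRearr_comp_eq_of_map_eq {κ e : ℝ → ℕ} (hκ : Measurable κ) (he : Measurable e)
    (h : vol01.map e = vol01.map κ) (a : ℕ → ℝ≥0∞) :
    decRearr (fun t => a (e t)) = decRearr (fun t => a (κ t)) := by
  have key : ∀ ρ, vol01 {t | ρ < a (e t)} = vol01 {t | ρ < a (κ t)} := fun ρ => by
    have := congrArg (fun μ => μ {i | ρ < a i}) h
    rwa [Measure.map_apply he .of_discrete, Measure.map_apply hκ .of_discrete] at this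
  ext s
  simp only [decRearr, key]

theorem IsRINorm.dilated_add_le_simpleFunc {N : (ℝ → ℝ≥0∞) → ℝ≥0∞} (hN : IsRINorm N) {p : ℝ}
    (hp : 1 ≤ p) (φ ψ : SimpleFunc ℝ ℝ≥0∞) :
    N (fun t => decRearr (fun x => φ x + ψ x) (t ^ p)) ≤
      N (fun t => decRearr φ (t ^ p)) + N (fun t => decRearr ψ (t ^ p)) := by
  obtain ⟨ι, c, hc, hanti⟩ := Finset.exists_antitone_enumeration (φ.pair ψ).range
    (fun v => v.1 + v.2) (0, 0) (by simp)
  let κ : SimpleFunc ℝ ℕ := (φ.pair ψ).map ι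
  have hcκ : ∀ x, c (κ x) = (φ x, ψ x) := fun x => hc _ ((φ.pair ψ).mem_range_self x)
  obtain ⟨e, hem, hemono, hmap⟩ := exists_monotoneOn_map_eq κ
  have heq := decRearr_comp_eq_of_map_eq κ.measurable hem hmap
  have h1 := heq fun i => (c i).1
  have h2 := heq fun i => (c i).2
  have h3 := heq fun i => (c i).1 + (c i).2
  simp only [hcκ] at h1 h2 h3
  have hmeas : ∀ a : ℕ → ℝ≥0∞, Measurable fun t => a (e t) :=
    fun a => measurable_from_nat.comp hem
  calc N (fun t => decRearr (fun x => φ x + ψ x) (t ^ p))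
      ≤ N (fun t => (c (e (t ^ p))).1 + (c (e (t ^ p))).2) := by
        refine hN.mono _ _ (ae_vol01_mem.mono fun t ht => ?_)
        rw [← h3]
        exact decRearr_le_self_of_antitoneOn
          (fun x hx y hy hxy => hanti (hemono hx hy hxy)) (rpow_mem_Ioo (by linarith) ht)
    _ ≤ N (fun t => (c (e (t ^ p))).1) + N (fun t => (c (e (t ^ p))).2) := hN.add_le _ _
    _ ≤ _ := by
        refine add_le_add ((hN.comp_rpow_le hp (hmeas fun i => (c i).1)).trans_eq ?_)
          ((hN.comp_rpow_le hp (hmeas fun i => (c i).2)).trans_eq ?_)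
        · rw [h1]
        · rw [h2]

theorem IsRINorm.dilated_mono {N : (ℝ → ℝ≥0∞) → ℝ≥0∞} (hN : IsRINorm N) (p : ℝ)
    {f g : ℝ → ℝ≥0∞} (h : ∀ᵐ t ∂vol01, f t ≤ g t) :
    N (fun t => decRearr f (t ^ p)) ≤ N (fun t => decRearr g (t ^ p)) :=
  hN.mono _ _ (ae_of_all _ fun _ => decRearr_mono h _)

theorem IsRINorm.dilated_iSup_eq {N : (ℝ → ℝ≥0∞) → ℝ≥0∞} (hN : IsRINorm N) (p : ℝ)
    {f : ℕ → ℝ → ℝ≥0∞} {g : ℝ → ℝ≥0∞} (hf : ∀ k, ∀ᵐ t ∂vol01, f k t ≤ f (k + 1) t)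
    (hg : ∀ᵐ t ∂vol01, (⨆ k, f k t) = g t) :
    N (fun t => decRearr g (t ^ p)) = ⨆ k, N (fun t => decRearr (f k) (t ^ p)) :=
  hN.iSup_eq _ _ (fun k => ae_of_all _ fun _ => decRearr_mono (hf k) _)
    (ae_of_all _ fun _ => decRearr_iSup hf hg _)

theorem IsRINorm.dilated_add_le {N : (ℝ → ℝ≥0∞) → ℝ≥0∞} (hN : IsRINorm N) {p : ℝ} (hp : 1 ≤ p)
    (f g : ℝ → ℝ≥0∞) :
    N (fun t => decRearr (fun x => f x + g x) (t ^ p)) ≤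
      N (fun t => decRearr f (t ^ p)) + N (fun t => decRearr g (t ^ p)) := by
  obtain ⟨F, hFm, hfF, hF⟩ := exists_measurable_ge_decRearr_eq f
  obtain ⟨G, hGm, hgG, hG⟩ := exists_measurable_ge_decRearr_eq g
  refine (hN.dilated_mono p (ae_of_all _ fun x => add_le_add (hfF x) (hgG x))).trans ?_
  rw [← hF, ← hG]
  have hmF := SimpleFunc.monotone_eapprox F
  have hmG := SimpleFunc.monotone_eapprox G
  rw [hN.dilated_iSup_eq p (f := fun k x => SimpleFunc.eapprox F k x + SimpleFunc.eapprox G k x)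
    (fun k => ae_of_all _ fun x => add_le_add (hmF k.le_succ x) (hmG k.le_succ x))
    (ae_of_all _ fun x => ?_)]
  · exact iSup_le fun k => (hN.dilated_add_le_simpleFunc hp _ _).trans <| add_le_add
      (hN.dilated_mono p (ae_of_all _ fun x =>
        (le_iSup (fun n => SimpleFunc.eapprox F n x) k).trans_eq
          (SimpleFunc.iSup_eapprox_apply hFm x)))
      (hN.dilated_mono p (ae_of_all _ fun x =>
        (le_iSup (fun n => SimpleFunc.eapprox G n x) k).trans_eq
          (SimpleFunc.iSup_eapprox_apply hGm x)))
  · rw [← SimpleFunc.iSup_eapprox_apply hFm x, ← SimpleFunc.iSup_eapprox_apply hGm x,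
      ENNReal.iSup_add_iSup_of_monotone (fun i j hij => hmF hij x) (fun i j hij => hmG hij x)]

theorem IsRINorm.exists_lintegral_le_dilated {N : (ℝ → ℝ≥0∞) → ℝ≥0∞} (hN : IsRINorm N) {p : ℝ}
    (hp : 1 ≤ p) :
    ∃ C : ℝ≥0, ∀ f : ℝ → ℝ≥0∞,
      ∫⁻ t, f t ∂vol01 ≤ (C : ℝ≥0∞) * N (fun t => decRearr f (t ^ p)) := by
  obtain ⟨C, hC⟩ := hN.exists_integral_le (Ioo 0 1) measurableSet_Ioo subset_rfl
  refine ⟨p.toNNReal * C, fun f => ?_⟩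
  obtain ⟨g, hgm, hgf, hg⟩ := exists_measurable_le_lintegral_eq vol01 f
  have hp0 : 0 < p := by linarith
  calc ∫⁻ t, f t ∂vol01 = ∫⁻ t, ENNReal.ofReal (p * t ^ (p - 1)) * g (t ^ p) ∂vol01 := by
        rw [hg, lintegral_vol01_rpow hp0]
    _ ≤ ∫⁻ t, ENNReal.ofReal p * g (t ^ p) ∂vol01 := by
        refine lintegral_mono_ae (ae_vol01_mem.mono fun t ht => ?_)
        gcongr
        exact mul_le_of_le_one_right hp0.le
          (Real.rpow_le_one ht.1.le ht.2.le (by linarith))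
    _ = ENNReal.ofReal p * ∫⁻ t, g (t ^ p) ∂vol01 :=
        lintegral_const_mul' _ _ ENNReal.ofReal_ne_top
    _ ≤ ENNReal.ofReal p * (C * N (fun t => decRearr f (t ^ p))) := by
        gcongr
        exact (hC _).trans (by
          gcongr
          exact (hN.comp_rpow_le hp hgm).trans (hN.dilated_mono p (ae_of_all _ hgf)))
    _ = _ := by
        rw [ENNReal.coe_mul, mul_assoc]
        rfl

theorem IsRINorm.dilated_eq_zero_iff {N : (ℝ → ℝ≥0∞) → ℝ≥0∞} (hN : IsRINorm N) {p : ℝ}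
    (hp : 1 ≤ p) (f : ℝ → ℝ≥0∞) :
    N (fun t => decRearr f (t ^ p)) = 0 ↔ ∀ᵐ t ∂vol01, f t = 0 := by
  constructor
  · intro h
    obtain ⟨g, hgm, hfg, hg⟩ := exists_measurable_ge_decRearr_eq f
    obtain ⟨C, hC⟩ := hN.exists_lintegral_le_dilated hp
    have h0 : ∫⁻ t, g t ∂vol01 = 0 := by
      simpa [hg, h] using hC g
    filter_upwards [(lintegral_eq_zero_iff hgm).mp h0] with t ht
    exact le_antisymm ((hfg t).trans_eq ht) zero_le
  · intro h
    refine (hN.eq_zero_iff _).mpr (ae_of_all _ fun t => le_antisymm ?_ zero_le)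
    rw [decRearr_le_iff]
    have : vol01 {t | 0 < f t} = 0 := measure_eq_zero_iff_ae_notMem.mpr
      (h.mono fun t ht => by simp [ht])
    simp [this]

/-- **The dilated rearrangement norm is a rearrangement-invariant function norm:**
if `‖·‖_Y` is a rearrangement-invariant function norm on `(0,1)`, then so is
`f ↦ ‖ t ↦ f*(t^{n/d}) ‖_Y`; in particular it satisfies the triangle inequality. -/
theorem dilated_rearrangement_norm_is_RINorm (n : ℕ) (hn : 2 ≤ n)
    (d : ℝ) (hd0 : 0 < d) (hdn : d ≤ n)
    (NY : (ℝ → ℝ≥0∞) → ℝ≥0∞) (hY : IsRINorm NY) :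
    IsRINorm (fun f => NY (fun t => decRearr f (t ^ ((n : ℝ) / d)))) := by
  have hp : 1 ≤ (n : ℝ) / d := (one_le_div hd0).mpr hdn
  refine ⟨hY.dilated_eq_zero_iff hp, fun c f => ?_, hY.dilated_add_le hp,
    fun f g => hY.dilated_mono _, fun f g => hY.dilated_iSup_eq _, fun E hE hE01 => ?_,
    fun E _ hE01 => ?_, fun f g h => by rw [h]⟩
  · simp only [decRearr_const_mul]
    exact hY.smul c _
  · refine lt_of_le_of_lt (hY.mono _ _ (ae_vol01_mem.mono fun t ht => ?_))
      (hY.indicator_lt_top (Ioo 0 1) measurableSet_Ioo subset_rfl)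
    rw [indicator_of_mem ht, decRearr_le_iff]
    have : {t | (1 : ℝ → ℝ≥0∞) t < E.indicator 1 t} = ∅ :=
      eq_empty_of_forall_notMem fun x hx =>
        (indicator_le_self' (f := (1 : ℝ → ℝ≥0∞)) (fun _ _ => zero_le) x).not_gt hx
    simp_all
  · obtain ⟨C, hC⟩ := hY.exists_lintegral_le_dilated hp
    exact ⟨C, fun f => (lintegral_mono_set hE01).trans (hC f)⟩
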